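/- Fix integers r ≥ s ≥ 2 and a vector a = (a_1, …, a_r) of nonnegative integers, not all zero. Then the set of pairs (C, b), where C is an integer and b = (b_1, …, b_r) is a vector of nonnegative integers such that σ_i(C, C+a) = σ_i(0, b) for all integers i with 1 ≤ i ≤ s, is finite. -/

import Mathlib

/-- The `k`-th elementary symmetric polynomial of the tuple `v`. -/
def esymm {R : Type*} [CommSemiring R] {n : ℕ} (v : Fin n → R) (k : ℕ) : R :=
  ∑ S ∈ Finset.powersetCard k Finset.univ, ∏ j ∈ S, v j

theorem esymm_one {R : Type*} [CommSemiring R] {n : ℕ} (v : Fin n → R) :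
    esymm v 1 = ∑ j, v j := by
  simp [esymm, Finset.powersetCard_one]

theorem sum_sq_eq_sq_sum_sub_two_mul_esymm_two {R : Type*} [CommRing R] {n : ℕ} (v : Fin n → R) :
    ∑ j, v j ^ 2 = (∑ j, v j) ^ 2 - 2 * esymm v 2 := by
  have h := congrArg (MvPolynomial.aeval v) (MvPolynomial.mul_esymm_eq_sum (Fin n) R 2)
  have hf : (Finset.HasAntidiagonal.antidiagonal 2).filter (fun x : ℕ × ℕ => x.1 < 2) =
      {(0, 2), (1, 1)} := by decide
  rw [hf, Finset.sum_pair (by decide)] at h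
  simp [MvPolynomial.psum, MvPolynomial.esymm, Finset.powersetCard_one] at h
  simp only [esymm]
  linear_combination h

/-- For `r ≥ s ≥ 2` and a nonzero nonnegative integer vector `a`, the set of pairs
`(C, b)` with `C` an integer and `b` a nonnegative integer vector such that
`σᵢ(C, C+a) = σᵢ(0, b)` for all `1 ≤ i ≤ s` is finite. -/
theorem stmt_7 (r s : ℕ) (hs : 2 ≤ s) (hsr : s ≤ r) (a : Fin r → ℕ)
    (ha : ∃ i, a i ≠ 0) :
    {p : ℤ × (Fin r → ℕ) | ∀ i : ℕ, 1 ≤ i → i ≤ s →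
      esymm (Fin.cons p.1 (fun j => p.1 + (a j : ℤ))) i =
        esymm (Fin.cons (0 : ℤ) (fun j => (p.2 j : ℤ))) i}.Finite := by
  set A : ℤ := ∑ j, (a j : ℤ) with hA
  set Q : ℤ := ∑ j, (a j : ℤ) ^ 2 with hQ
  have hA0 : 0 ≤ A := Finset.sum_nonneg fun _ _ => by positivity
  have hQ0 : 0 ≤ Q := Finset.sum_nonneg fun _ _ => by positivity
  refine ((Set.finite_Icc (-Q) Q).prod
    (Set.finite_Icc 0 (fun _ : Fin r => (((r : ℤ) + 1) * Q + A).toNat))).subset ?_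
  rintro ⟨C, b⟩ h
  have h₁ := h 1 le_rfl (by omega)
  have h₂ := h 2 (by omega) hs
  have hp : ∑ j, (Fin.cons C (fun j => C + (a j : ℤ)) : Fin (r + 1) → ℤ) j ^ 2 =
      ∑ j, (Fin.cons (0 : ℤ) (fun j => (b j : ℤ)) : Fin (r + 1) → ℤ) j ^ 2 := by
    rw [sum_sq_eq_sq_sum_sub_two_mul_esymm_two, sum_sq_eq_sq_sum_sub_two_mul_esymm_two,
      ← esymm_one, ← esymm_one, h₁, h₂]
  simp only [esymm_one, Fin.sum_univ_succ, Fin.cons_zero, Fin.cons_succ, Finset.sum_add_distrib,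
    Finset.sum_const, Finset.card_univ, Fintype.card_fin, nsmul_eq_mul, ← hA] at h₁
  simp only [Fin.sum_univ_succ, Fin.cons_zero, Fin.cons_succ, add_sq, Finset.sum_add_distrib,
    Finset.sum_const, Finset.card_univ, Fintype.card_fin, nsmul_eq_mul, ← hQ, ← Finset.mul_sum,
    ← hA] at hp
  have hcs : (∑ j, (b j : ℤ)) ^ 2 ≤ r * ∑ j, (b j : ℤ) ^ 2 := by
    simpa using sq_sum_le_card_mul_sum_sq (s := Finset.univ) (f := fun j => (b j : ℤ))
  have hB : ∑ j, (b j : ℤ) = (r + 1) * C + A := by linear_combination -h₁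
  have hB2 : ∑ j, (b j : ℤ) ^ 2 = (r + 1) * C ^ 2 + 2 * C * A + Q := by
    linear_combination -hp
  rw [hB, hB2] at hcs
  have hr : (0 : ℤ) < r := by exact_mod_cast (by omega : 0 < r)
  have hC : C ^ 2 ≤ Q := by
    refine le_of_mul_le_mul_left ?_ hr
    nlinarith [sq_nonneg (C + A)]
  have hC' : |C| ≤ Q := by
    have := Int.le_self_sq |C|
    rw [sq_abs] at this
    exact this.trans hC
  obtain ⟨hC₁, hC₂⟩ := abs_le.mp hC'
  refine ⟨⟨hC₁, hC₂⟩, fun j => Nat.zero_le _, fun j => ?_⟩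
  have hj : (b j : ℤ) ≤ ∑ j, (b j : ℤ) :=
    Finset.single_le_sum (f := fun j => (b j : ℤ)) (fun _ _ => by positivity) (Finset.mem_univ j)
  have hle : (b j : ℤ) ≤ (r + 1) * Q + A := by nlinarith
  change b j ≤ Int.toNat _
  omega
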